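/- arXiv:2206.07657 — 3 statements merged into one kernel-verified Lean document; each statement's English description precedes it below -/
import Mathlib

section
/- The Read–Bajraktarevic operator T maps 𝔽 into itself: for every f ∈ 𝔽, the function Tf is continuous on I and satisfies (Tf)(t_0) = F_1(L_1⁻¹(t_0), f(L_1⁻¹(t_0))) = x_0 and (Tf)(t_N) = F_N(L_N⁻¹(t_N), f(L_N⁻¹(t_N))) = x_N. -/
open Set

/-- The affine contraction `L_n : I → I_n` determined by `L_n(t_0) = t_{n-1}`, `L_n(t_N) = t_n`. -/
noncomputable def Lmap (t : ℕ → ℝ) (N n : ℕ) (s : ℝ) : ℝ :=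
  t (n - 1) + (t n - t (n - 1)) * (s - t 0) / (t N - t 0)

/-- The inverse map `L_n⁻¹ : I_n → I`. -/
noncomputable def LmapInv (t : ℕ → ℝ) (N n : ℕ) (y : ℝ) : ℝ :=
  t 0 + (t N - t 0) * (y - t (n - 1)) / (t n - t (n - 1))

/-- Continuous functions on consecutive closed intervals that take prescribed common values at the
partition points glue to a continuous function on the whole interval. -/
theorem exists_continuousOn_glue (t y : ℕ → ℝ) (g : ℕ → ℝ → ℝ) (M : ℕ)
    (ht : ∀ i, i < M → t i < t (i + 1))
    (hg : ∀ i, i < M → ContinuousOn (g i) (Icc (t i) (t (i + 1))))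
    (hl : ∀ i, i < M → g i (t i) = y i)
    (hr : ∀ i, i < M → g i (t (i + 1)) = y (i + 1)) :
    ∃ G : ℝ → ℝ, t 0 ≤ t M ∧ ContinuousOn G (Icc (t 0) (t M)) ∧
      (∀ i, i < M → t (i + 1) ≤ t M ∧ EqOn G (g i) (Icc (t i) (t (i + 1)))) ∧
      G (t 0) = y 0 ∧ G (t M) = y M := by
  induction M with
  | zero => exact ⟨fun _ => y 0, le_rfl, continuousOn_const, by simp, rfl, rfl⟩
  | succ M ih =>
    obtain ⟨G, h0M, hGc, hGe, hG0, hGM⟩ := ih (fun i hi => ht i (by omega))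
      (fun i hi => hg i (by omega)) (fun i hi => hl i (by omega)) (fun i hi => hr i (by omega))
    have hM := ht M (by omega)
    set H : ℝ → ℝ := fun u => if u ≤ t M then G u else g M u with hH
    have hle : ∀ u, u ≤ t M → H u = G u := fun u hu => if_pos hu
    have hge : EqOn H (g M) (Icc (t M) (t (M + 1))) := by
      intro u hu
      rcases hu.1.eq_or_lt with h | h
      · rw [hle u h.ge, ← h, hGM, hl M (by omega)]
      · exact if_neg h.not_ge
    refine ⟨H, h0M.trans hM.le, ?_, ?_, ?_, ?_⟩
    · rw [← Icc_union_Icc_eq_Icc h0M hM.le]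
      exact (hGc.congr fun u hu => hle u hu.2).union_of_isClosed
        ((hg M (by omega)).congr hge) isClosed_Icc isClosed_Icc
    · intro i hi
      rcases Nat.lt_succ_iff_lt_or_eq.mp hi with h | rfl
      · exact ⟨(hGe i h).1.trans hM.le, fun u hu =>
          (hle u (hu.2.trans (hGe i h).1)).trans ((hGe i h).2 hu)⟩
      · exact ⟨le_rfl, hge⟩
    · rw [hle _ h0M, hG0]
    · rw [hge ⟨hM.le, le_rfl⟩, hr M (by omega)]

theorem LmapInv_left (t : ℕ → ℝ) (N n : ℕ) : LmapInv t N n (t (n - 1)) = t 0 := by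
  simp [LmapInv]

theorem LmapInv_right {t : ℕ → ℝ} {n : ℕ} (N : ℕ) (h : t (n - 1) < t n) :
    LmapInv t N n (t n) = t N := by
  rw [LmapInv, mul_div_cancel_right₀ _ (sub_pos.2 h).ne']
  ring

theorem continuous_LmapInv (t : ℕ → ℝ) (N n : ℕ) : Continuous (LmapInv t N n) := by
  unfold LmapInv
  fun_prop

theorem mapsTo_LmapInv {t : ℕ → ℝ} {N n : ℕ} (hN : t 0 ≤ t N) (h : t (n - 1) < t n) :
    MapsTo (LmapInv t N n) (Icc (t (n - 1)) (t n)) (Icc (t 0) (t N)) := by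
  intro u hu
  have hd : 0 < t n - t (n - 1) := sub_pos.2 h
  have hN' : 0 ≤ t N - t 0 := sub_nonneg.2 hN
  have h1 : 0 ≤ (t N - t 0) * (u - t (n - 1)) / (t n - t (n - 1)) :=
    div_nonneg (mul_nonneg hN' (sub_nonneg.2 hu.1)) hd.le
  have h2 : (t N - t 0) * (u - t (n - 1)) / (t n - t (n - 1)) ≤ t N - t 0 := by
    rw [div_le_iff₀ hd]
    exact mul_le_mul_of_nonneg_left (by linarith [hu.2]) hN'
  constructor <;> unfold LmapInv <;> linarith

/-- the Read–Bajraktarevic operator `T` maps `𝔽` into itself: for every `f ∈ 𝔽`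
the piecewise-defined function `Tf` is continuous on `I` and satisfies
`(Tf)(t_0) = F_1(L_1⁻¹(t_0), f(L_1⁻¹(t_0))) = x_0` and
`(Tf)(t_N) = F_N(L_N⁻¹(t_N), f(L_N⁻¹(t_N))) = x_N`. -/
theorem rb_operator_maps_F_into_itself
    (N : ℕ) (hN : 2 ≤ N) (t x : ℕ → ℝ)
    (ht : ∀ i, i < N → t i < t (i + 1))
    (α : ℕ → ℝ) (q : ℕ → ℝ → ℝ)
    (hα : ∀ n, 1 ≤ n → n ≤ N → |α n| < 1)
    (hq : ∀ n, 1 ≤ n → n ≤ N → ContinuousOn (q n) (Icc (t 0) (t N)))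
    (hend : ∀ n, 1 ≤ n → n ≤ N →
      α n * x 0 + q n (t 0) = x (n - 1) ∧ α n * x N + q n (t N) = x n) :
    ∀ f : ℝ → ℝ, ContinuousOn f (Icc (t 0) (t N)) → f (t 0) = x 0 → f (t N) = x N →
      ∃ Tf : ℝ → ℝ,
        ContinuousOn Tf (Icc (t 0) (t N)) ∧
        (∀ n, 1 ≤ n → n ≤ N → ∀ u ∈ Icc (t (n - 1)) (t n),
          Tf u = α n * f (LmapInv t N n u) + q n (LmapInv t N n u)) ∧
        Tf (t 0) = α 1 * f (LmapInv t N 1 (t 0)) + q 1 (LmapInv t N 1 (t 0)) ∧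
        Tf (t 0) = x 0 ∧
        Tf (t N) = α N * f (LmapInv t N N (t N)) + q N (LmapInv t N N (t N)) ∧
        Tf (t N) = x N := by
  intro f hf hf0 hfN
  have h0N : t 0 ≤ t N := by
    have key : ∀ m, m ≤ N → t 0 ≤ t m := by
      intro m
      induction m with
      | zero => exact fun _ => le_rfl
      | succ m ih => exact fun hm => (ih (by omega)).trans (ht m hm).le
    exact key N le_rfl
  have hl : ∀ i, i < N → LmapInv t N (i + 1) (t i) = t 0 := fun i _ => LmapInv_left t N (i + 1)
  have hr : ∀ i, i < N → LmapInv t N (i + 1) (t (i + 1)) = t N :=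
    fun i hi => LmapInv_right (n := i + 1) N (ht i hi)
  obtain ⟨G, -, hGc, hGe, hG0, hGN⟩ := exists_continuousOn_glue t x
    (fun i u => α (i + 1) * f (LmapInv t N (i + 1) u) + q (i + 1) (LmapInv t N (i + 1) u)) N ht
    (fun i hi => by
      have hm := mapsTo_LmapInv (n := i + 1) h0N (ht i hi)
      have hc := (continuous_LmapInv t N (i + 1)).continuousOn (s := Icc (t i) (t (i + 1)))
      exact (continuousOn_const.mul (hf.comp hc hm)).add
        ((hq (i + 1) (by omega) (by omega)).comp hc hm))
    (fun i hi => by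
      simpa only [hl i hi, hf0, Nat.add_sub_cancel] using (hend (i + 1) (by omega) (by omega)).1)
    (fun i hi => by
      simpa only [hr i hi, hfN] using (hend (i + 1) (by omega) (by omega)).2)
  have hpiece : ∀ n, 1 ≤ n → n ≤ N → ∀ u ∈ Icc (t (n - 1)) (t n),
      G u = α n * f (LmapInv t N n u) + q n (LmapInv t N n u) := by
    intro n hn hnN u hu
    obtain ⟨i, rfl⟩ := Nat.exists_eq_add_of_le' hn
    exact (hGe i (by omega)).2 hu
  refine ⟨G, hGc, hpiece, ?_, hG0, ?_, hGN⟩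
  · exact hpiece 1 le_rfl (by omega) _ ⟨le_rfl, (ht 0 (by omega)).le⟩
  · obtain ⟨m, rfl⟩ := Nat.exists_eq_add_of_le' (show 1 ≤ N by omega)
    exact hpiece (m + 1) (by omega) le_rfl _ ⟨(ht m (by omega)).le, le_rfl⟩
end

section
/- The Read–Bajraktarevic operator T is a contraction on the metric space (𝔽, d): for all f, g ∈ 𝔽, d(Tf, Tg) ≤ δ · d(f, g), where δ = max_{1 ≤ n ≤ N} |α_n| < 1. -/
open Set

/-- The consecutive intervals `[t (n - 1), t n]`, `1 ≤ n ≤ N`, cover `[t 0, t N]`. -/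
lemma exists_mem_Icc_partition (t : ℕ → ℝ) {N : ℕ} (hN : 1 ≤ N) {u : ℝ}
    (hu : u ∈ Icc (t 0) (t N)) :
    ∃ n, 1 ≤ n ∧ n ≤ N ∧ u ∈ Icc (t (n - 1)) (t n) := by
  induction N, hN using Nat.le_induction with
  | base => exact ⟨1, le_rfl, le_rfl, hu⟩
  | succ k hk ih =>
    rcases le_total u (t k) with h | h
    · obtain ⟨n, h1, h2, h3⟩ := ih ⟨hu.1, h⟩
      exact ⟨n, h1, by omega, h3⟩
    · exact ⟨k + 1, by omega, le_rfl, by simpa using h, hu.2⟩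

/-- `LmapInv t N n` maps the `n`-th subinterval into the whole interval. -/
lemma LmapInv_mem_Icc (t : ℕ → ℝ) {N n : ℕ} (hN : t 0 ≤ t N) (hn : t (n - 1) < t n) {u : ℝ}
    (hu : u ∈ Icc (t (n - 1)) (t n)) : LmapInv t N n u ∈ Icc (t 0) (t N) := by
  have hd : 0 < t n - t (n - 1) := sub_pos.2 hn
  have hI : 0 ≤ t N - t 0 := sub_nonneg.2 hN
  unfold LmapInv
  constructor
  · have : 0 ≤ (t N - t 0) * (u - t (n - 1)) / (t n - t (n - 1)) :=
      div_nonneg (mul_nonneg hI (sub_nonneg.2 hu.1)) hd.le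
    linarith
  · have : (t N - t 0) * (u - t (n - 1)) / (t n - t (n - 1)) ≤ t N - t 0 := by
      rw [div_le_iff₀ hd]
      exact mul_le_mul_of_nonneg_left (by linarith [hu.2]) hI
    linarith

/-- the Read–Bajraktarevic operator `T` is a contraction on `(𝔽, d)`:
for all `f, g ∈ 𝔽`, `d(Tf, Tg) ≤ δ · d(f, g)` where `δ = max_{1 ≤ n ≤ N} |α_n| < 1`
and `d` is the supremum metric on `I`. -/
theorem rb_operator_contraction
    (N : ℕ) (hN : 2 ≤ N) (t x : ℕ → ℝ)
    (ht : ∀ i, i < N → t i < t (i + 1))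
    (α : ℕ → ℝ) (q : ℕ → ℝ → ℝ)
    (hα : ∀ n, 1 ≤ n → n ≤ N → |α n| < 1)
    (hq : ∀ n, 1 ≤ n → n ≤ N → ContinuousOn (q n) (Icc (t 0) (t N)))
    (hend : ∀ n, 1 ≤ n → n ≤ N →
      α n * x 0 + q n (t 0) = x (n - 1) ∧ α n * x N + q n (t N) = x n) :
    ∀ f g Tf Tg : ℝ → ℝ,
      ContinuousOn f (Icc (t 0) (t N)) → f (t 0) = x 0 → f (t N) = x N →
      ContinuousOn g (Icc (t 0) (t N)) → g (t 0) = x 0 → g (t N) = x N →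
      (∀ n, 1 ≤ n → n ≤ N → ∀ u ∈ Icc (t (n - 1)) (t n),
        Tf u = α n * f (LmapInv t N n u) + q n (LmapInv t N n u)) →
      (∀ n, 1 ≤ n → n ≤ N → ∀ u ∈ Icc (t (n - 1)) (t n),
        Tg u = α n * g (LmapInv t N n u) + q n (LmapInv t N n u)) →
      (Finset.Icc 1 N).sup' (Finset.nonempty_Icc.mpr (by omega)) (fun n => |α n|) < 1 ∧
      (⨆ u : Icc (t 0) (t N), |Tf u.1 - Tg u.1|) ≤
        (Finset.Icc 1 N).sup' (Finset.nonempty_Icc.mpr (by omega)) (fun n => |α n|) *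
          ⨆ u : Icc (t 0) (t N), |f u.1 - g u.1| := by
  intro f g Tf Tg hf _ _ hg _ _ hTf hTg
  have h0N : t 0 ≤ t N := by
    have key : ∀ m, m ≤ N → t 0 ≤ t m := by
      intro m
      induction m with
      | zero => intro _; exact le_rfl
      | succ m ih => intro hm; exact (ih (by omega)).trans (ht m (by omega)).le
    exact key N le_rfl
  refine ⟨?_, ?_⟩
  · rw [Finset.sup'_lt_iff]
    intro n hn
    rw [Finset.mem_Icc] at hn
    exact hα n hn.1 hn.2
  · have hbdd : BddAbove (range fun u : Icc (t 0) (t N) => |f u.1 - g u.1|) := by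
      have h := (isCompact_Icc.image_of_continuousOn (hf.sub hg).abs).bddAbove
      rwa [image_eq_range] at h
    have : Nonempty (Icc (t 0) (t N)) := ⟨⟨t 0, left_mem_Icc.2 h0N⟩⟩
    refine ciSup_le fun u => ?_
    obtain ⟨n, h1, h2, hu⟩ := exists_mem_Icc_partition t (by omega) u.2
    have hlt : t (n - 1) < t n := by
      have h := ht (n - 1) (by omega)
      rwa [Nat.sub_add_cancel h1] at h
    have hle : |α n| ≤ (Finset.Icc 1 N).sup' (Finset.nonempty_Icc.mpr (by omega))
        (fun n => |α n|) :=
      Finset.le_sup' (fun n => |α n|) (Finset.mem_Icc.2 ⟨h1, h2⟩)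
    rw [hTf n h1 h2 u hu, hTg n h1 h2 u hu, add_sub_add_right_eq_sub, ← mul_sub, abs_mul]
    exact mul_le_mul hle (le_ciSup hbdd ⟨_, LmapInv_mem_Icc t h0N hlt hu⟩) (abs_nonneg _)
      ((abs_nonneg _).trans hle)
end

section
/- Suppose the nodes are equally spaced, t_n = t_0 + n·h with step h > 0, and each q_n is affine, q_n(t) = q_{n1} t + q_{n0}. Let g be the fractal interpolation function (the unique fixed point of T in 𝔽), let α = max_{1 ≤ n ≤ N} |α_n| < 1, let f : I → ℝ be any continuous function with f(t_n) = x_n for all n = 0,…,N, and let ω ≥ 0 be such that |f(s) − f(u)| ≤ ω whenever s, u ∈ I and |s − u| ≤ h. Then sup_{t ∈ I} |f(t) − g(t)| ≤ ω + (2α/(1 − α)) · sup_{t ∈ I} |f(t)|. -/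
open Set

theorem exists_mem_Icc_nodes {t : ℕ → ℝ} {N : ℕ} (hN : 1 ≤ N) {u : ℝ}
    (hu : u ∈ Icc (t 0) (t N)) :
    ∃ n, 1 ≤ n ∧ n ≤ N ∧ u ∈ Icc (t (n - 1)) (t n) := by
  classical
  have hex : ∃ n, 1 ≤ n ∧ u ≤ t n := ⟨N, hN, hu.2⟩
  obtain ⟨h1, h2⟩ := Nat.find_spec hex
  refine ⟨Nat.find hex, h1, Nat.find_min' hex ⟨hN, hu.2⟩, ?_, h2⟩
  rcases Nat.lt_or_ge 1 (Nat.find hex) with hlt | hle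
  · have hmin := Nat.find_min hex (m := Nat.find hex - 1) (by omega)
    push Not at hmin
    exact (hmin (by omega)).le
  · rw [le_antisymm hle h1]
    exact hu.1

theorem ContinuousOn.abs_le_ciSup_Icc {f : ℝ → ℝ} {a b u : ℝ} (hf : ContinuousOn f (Icc a b))
    (hu : u ∈ Icc a b) : |f u| ≤ ⨆ v : Icc a b, |f v.1| := by
  obtain ⟨C, hC⟩ := isCompact_Icc.exists_bound_of_continuousOn hf
  refine le_ciSup (f := fun v : Icc a b => |f v.1|) ⟨C, ?_⟩ ⟨u, hu⟩
  rintro _ ⟨v, rfl⟩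
  exact hC v.1 v.2

theorem abs_convexComb_le {a b l c : ℝ} (hl0 : 0 ≤ l) (hl1 : l ≤ 1) (ha : |a| ≤ c)
    (hb : |b| ≤ c) : |(1 - l) * a + l * b| ≤ c := by
  rw [abs_le] at *
  constructor <;> nlinarith

/-- The value `p` is that of the piecewise linear interpolant of the data at `u`. -/
theorem exists_linear_interpolant_value {t x : ℕ → ℝ} {N n : ℕ} {a b c F G ω u : ℝ}
    {f g : ℝ → ℝ} (h0N : t 0 < t N) (hlt : t (n - 1) < t n)
    (hu : u ∈ Icc (t (n - 1)) (t n))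
    (hl : a * x 0 + (b * t 0 + c) = x (n - 1)) (hr : a * x N + (b * t N + c) = x n)
    (hgu : g u = a * g (LmapInv t N n u) + (b * LmapInv t N n u + c))
    (hx0 : |x 0| ≤ F) (hxN : |x N| ≤ F) (hxl : |x (n - 1)| ≤ F) (hxr : |x n| ≤ F)
    (hG : ∀ v ∈ Icc (t 0) (t N), |g v| ≤ G)
    (hfl : |f u - x (n - 1)| ≤ ω) (hfr : |f u - x n| ≤ ω) :
    ∃ p, |f u - p| ≤ ω ∧ |p| ≤ F ∧ |g u - p| ≤ |a| * (G + F) := by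
  have hd : 0 < t n - t (n - 1) := sub_pos.2 hlt
  set l := (u - t (n - 1)) / (t n - t (n - 1))
  have hl0 : 0 ≤ l := div_nonneg (sub_nonneg.2 hu.1) hd.le
  have hl1 : l ≤ 1 := (div_le_one hd).2 (by linarith [hu.2])
  have hv : LmapInv t N n u = t 0 + (t N - t 0) * l := by
    rw [LmapInv, mul_div_assoc]
  have hvmem : LmapInv t N n u ∈ Icc (t 0) (t N) := by
    rw [hv]
    constructor <;> nlinarith
  refine ⟨(1 - l) * x (n - 1) + l * x n, ?_, abs_convexComb_le hl0 hl1 hxl hxr, ?_⟩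
  · rw [show f u - ((1 - l) * x (n - 1) + l * x n)
      = (1 - l) * (f u - x (n - 1)) + l * (f u - x n) by ring]
    exact abs_convexComb_le hl0 hl1 hfl hfr
  · have heq : g u - ((1 - l) * x (n - 1) + l * x n)
        = a * (g (LmapInv t N n u) - ((1 - l) * x 0 + l * x N)) := by
      rw [hgu, ← hl, ← hr]
      linear_combination b * hv
    rw [heq, abs_mul]
    gcongr
    exact (abs_sub _ _).trans (add_le_add (hG _ hvmem) (abs_convexComb_le hl0 hl1 hx0 hxN))

/-- with equally spaced nodes of step `h > 0` and affine `q_n`, if `g` is the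
fractal interpolation function, `α = max_{1≤n≤N} |α_n|`, `f` is any continuous interpolant of
the data, and `ω` bounds the oscillation of `f` at scale `h`, then
`‖f − g‖_∞ ≤ ω + (2α/(1−α)) ‖f‖_∞`. -/
theorem fif_approximation_error_bound
    (N : ℕ) (hN : 2 ≤ N) (t x : ℕ → ℝ)
    (ht : ∀ i, i < N → t i < t (i + 1))
    (h : ℝ) (hh : 0 < h)
    (hstep : ∀ n, n ≤ N → t n = t 0 + n * h)
    (α : ℕ → ℝ) (q : ℕ → ℝ → ℝ) (q1 q0 : ℕ → ℝ)
    (hα : ∀ n, 1 ≤ n → n ≤ N → |α n| < 1)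
    (hqaff : ∀ n, 1 ≤ n → n ≤ N → ∀ s : ℝ, q n s = q1 n * s + q0 n)
    (hend : ∀ n, 1 ≤ n → n ≤ N →
      α n * x 0 + q n (t 0) = x (n - 1) ∧ α n * x N + q n (t N) = x n)
    (g : ℝ → ℝ)
    (hg : ContinuousOn g (Icc (t 0) (t N)))
    (hg0 : g (t 0) = x 0) (hgN : g (t N) = x N)
    (hgfix : ∀ n, 1 ≤ n → n ≤ N → ∀ u ∈ Icc (t (n - 1)) (t n),
      g u = α n * g (LmapInv t N n u) + q n (LmapInv t N n u))
    (f : ℝ → ℝ)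
    (hf : ContinuousOn f (Icc (t 0) (t N)))
    (hfi : ∀ n, n ≤ N → f (t n) = x n)
    (ω : ℝ) (hω : 0 ≤ ω)
    (hmod : ∀ s ∈ Icc (t 0) (t N), ∀ u ∈ Icc (t 0) (t N), |s - u| ≤ h → |f s - f u| ≤ ω) :
    (⨆ u : Icc (t 0) (t N), |f u.1 - g u.1|) ≤
      ω + (2 * (Finset.Icc 1 N).sup' (Finset.nonempty_Icc.mpr (by omega)) (fun n => |α n|) /
            (1 - (Finset.Icc 1 N).sup' (Finset.nonempty_Icc.mpr (by omega)) (fun n => |α n|))) *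
          ⨆ u : Icc (t 0) (t N), |f u.1| := by
  have hne : (Finset.Icc 1 N).Nonempty := Finset.nonempty_Icc.mpr (by omega)
  set A := (Finset.Icc 1 N).sup' hne (fun n => |α n|)
  have hA : ∀ n, 1 ≤ n → n ≤ N → |α n| ≤ A := fun n h1 h2 =>
    Finset.le_sup' (fun n => |α n|) (Finset.mem_Icc.2 ⟨h1, h2⟩)
  have hA0 : 0 ≤ A := (abs_nonneg _).trans (hA 1 le_rfl (by omega))
  have hA1 : A < 1 := (Finset.sup'_lt_iff hne).2 fun n hn =>
    hα n (Finset.mem_Icc.1 hn).1 (Finset.mem_Icc.1 hn).2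
  set F := ⨆ u : Icc (t 0) (t N), |f u.1|
  set G := ⨆ u : Icc (t 0) (t N), |g u.1|
  have hmem : ∀ n, n ≤ N → t n ∈ Icc (t 0) (t N) := by
    intro n hn
    have hcast : (n : ℝ) ≤ N := by exact_mod_cast hn
    rw [hstep n hn, hstep N le_rfl]
    constructor
    · have := mul_nonneg (Nat.cast_nonneg (α := ℝ) n) hh.le
      linarith
    · gcongr
  have hx : ∀ n, n ≤ N → |x n| ≤ F := fun n hn => by
    rw [← hfi n hn]
    exact hf.abs_le_ciSup_Icc (hmem n hn)
  have h0N : t 0 < t N :=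
    (by simpa using ht 0 (by omega) : t 0 < t 1).trans_le (hmem 1 (by omega)).2
  have : Nonempty (Icc (t 0) (t N)) := ⟨⟨t 0, left_mem_Icc.2 h0N.le⟩⟩
  have hF0 : 0 ≤ F := (abs_nonneg _).trans (hx 0 (by omega))
  have hG0 : 0 ≤ G := (abs_nonneg _).trans (hg.abs_le_ciSup_Icc (left_mem_Icc.2 h0N.le))
  have key : ∀ u ∈ Icc (t 0) (t N),
      ∃ p, |f u - p| ≤ ω ∧ |p| ≤ F ∧ |g u - p| ≤ A * (G + F) := by
    intro u hu
    obtain ⟨n, h1, h2, hun⟩ := exists_mem_Icc_nodes (by omega) hu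
    have hd : t n - t (n - 1) = h := by
      rw [hstep n h2, hstep (n - 1) (by omega), Nat.cast_sub h1]
      push_cast
      ring
    obtain ⟨hl, hr⟩ := hend n h1 h2
    have hgu := hgfix n h1 h2 u hun
    rw [hqaff n h1 h2] at hl hr hgu
    have hfl : |f u - x (n - 1)| ≤ ω := by
      rw [← hfi (n - 1) (by omega)]
      exact hmod _ hu _ (hmem _ (by omega)) (abs_le.2 ⟨by linarith [hun.1], by linarith [hun.2]⟩)
    have hfr : |f u - x n| ≤ ω := by
      rw [← hfi n h2]
      exact hmod _ hu _ (hmem _ h2) (abs_le.2 ⟨by linarith [hun.1], by linarith [hun.2]⟩)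
    obtain ⟨p, hp1, hp2, hp3⟩ := exists_linear_interpolant_value h0N (by linarith) hun hl hr hgu
      (hx 0 (by omega)) (hx N le_rfl) (hx _ (by omega)) (hx n h2)
      (fun v hv => hg.abs_le_ciSup_Icc hv) hfl hfr
    exact ⟨p, hp1, hp2, hp3.trans (mul_le_mul_of_nonneg_right (hA n h1 h2) (by positivity))⟩
  have hGle : G ≤ F + A * (G + F) := ciSup_le fun ⟨u, hu⟩ => by
    obtain ⟨p, -, hp2, hp3⟩ := key u hu
    have := abs_add_le p (g u - p)
    rw [add_sub_cancel] at this
    linarith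
  have hbound : A * (G + F) ≤ 2 * A / (1 - A) * F := by
    have h1A : 0 < 1 - A := by linarith
    rw [div_mul_eq_mul_div, le_div_iff₀ h1A]
    nlinarith
  refine ciSup_le fun ⟨u, hu⟩ => ?_
  obtain ⟨p, hp1, -, hp3⟩ := key u hu
  have := abs_sub_le (f u) p (g u)
  rw [abs_sub_comm p] at this
  linarith
end
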